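/- Finite-time risk bound for the fast iterate (Proposition 1(i)). Suppose the projected two-timescale SA iterates (λ_t, ξ_t) are driven by a Markov process with kernel 𝒦 started at w ∈ 𝒲, that (𝒦, ν, c₁, ρ) satisfies the U_d-geometric-ergodicity bound for d = 1 and for d = 2, that Assumption 2 holds, and that ζ·α₀ > 1 in case κ = 1 and ψ·β₀ > 1 in case δ = 1. Then there exist constants k₁ ≥ 0 and k₂ > 0 (depending on w) and an integer T such that for all t ≥ T: E[‖λ_t − λ*‖²] ≤ t^{−κ}·(k₁·ln t + k₂). Moreover, if 𝒦(w') = ν for every w' ∈ 𝒲 (so W₁, W₂, … are i.i.d. with law ν), the constant k₁ can be taken to be 0. -/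

import Mathlib

open MeasureTheory ProbabilityTheory Filter
open scoped RealInnerProductSpace

noncomputable section

/-- Euclidean state space. -/
abbrev Wsp (dW : ℕ) : Type := EuclideanSpace ℝ (Fin dW)

/-- `t`-step iterate of a Markov kernel. -/
noncomputable def kiter {α : Type*} [MeasurableSpace α] (K : Kernel α α) : ℕ → Kernel α α :=
  fun t => Nat.rec (motive := fun _ => Kernel α α) Kernel.id (fun _ ih => ih.comp K) t

instance kiter_isMarkovKernel {α : Type*} [MeasurableSpace α] (K : Kernel α α)
    [IsMarkovKernel K] (t : ℕ) : IsMarkovKernel (kiter K t) := by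
  induction t with
  | zero => exact inferInstanceAs (IsMarkovKernel (Kernel.id))
  | succ n ih => exact inferInstanceAs (IsMarkovKernel ((kiter K n).comp K))

/-- U_d geometric ergodicity bound. -/
def UdBound {dW : ℕ} (K : Kernel (Wsp dW) (Wsp dW)) [IsMarkovKernel K]
    (ν : Measure (Wsp dW)) [IsProbabilityMeasure ν] (c₁ ρ d : ℝ) : Prop :=
  Integrable (fun w' => (1 : ℝ) + ‖w'‖ ^ d) ν ∧
  ∀ (t : ℕ) (w : Wsp dW) (f : Wsp dW → ℝ), Measurable f →
    (∀ w', |f w'| ≤ 1 + ‖w'‖ ^ d) →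
      (∫ w', |f w'|
          ∂((((kiter K t) w).toSignedMeasure - ν.toSignedMeasure).totalVariation))
        ≤ c₁ * ρ ^ t * (1 + ‖w‖ ^ d)

/-- Markov process with kernel `K` started at `w`. -/
structure IsMarkovProc {dW : ℕ} {Ω : Type*} [MeasurableSpace Ω]
    (K : Kernel (Wsp dW) (Wsp dW)) (P : Measure Ω)
    (Wp : ℕ → Ω → Wsp dW) (w : Wsp dW) : Prop where
  meas : ∀ t, Measurable (Wp t)
  init : ∀ᵐ ω ∂P, Wp 0 ω = w
  markov : ∀ (t : ℕ) (f : Wsp dW → ℝ), Measurable f → (∃ C, ∀ x, |f x| ≤ C) →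
    (P[(fun ω => f (Wp (t+1) ω)) |
        ⨆ s ∈ Finset.range (t+1), MeasurableSpace.comap (Wp s) inferInstance])
      =ᵐ[P] fun ω => ∫ x, f x ∂(K (Wp t ω))

/-- Metric projection onto the closed ball of radius `B` centered at the origin. -/
def projB {E : Type*} [NormedAddCommGroup E] [NormedSpace ℝ E] (B : ℝ) (x : E) : E :=
  if ‖x‖ ≤ B then x else (B / ‖x‖) • x

/-- The slow (first-stage) SA iterates. -/
def xiSeq {dW dX : ℕ} {Ω : Type*}
    (H : Wsp dW → EuclideanSpace ℝ (Fin dX) → EuclideanSpace ℝ (Fin dX))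
    (β : ℕ → ℝ) (B : ℝ) (Wp : ℕ → Ω → Wsp dW) (xi0 : EuclideanSpace ℝ (Fin dX)) :
    ℕ → Ω → EuclideanSpace ℝ (Fin dX) :=
  fun t => Nat.rec (motive := fun _ => Ω → EuclideanSpace ℝ (Fin dX)) (fun _ => xi0)
    (fun s ih => fun ω => projB B (ih ω + β s • H (Wp s ω) (ih ω))) t

/-- The fast SA iterates. -/
def lamSeq {dW dL dX : ℕ} {Ω : Type*}
    (G : Wsp dW → EuclideanSpace ℝ (Fin dL) → EuclideanSpace ℝ (Fin dX) →
      EuclideanSpace ℝ (Fin dL))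
    (H : Wsp dW → EuclideanSpace ℝ (Fin dX) → EuclideanSpace ℝ (Fin dX))
    (α β : ℕ → ℝ) (B : ℝ) (Wp : ℕ → Ω → Wsp dW)
    (lam0 : EuclideanSpace ℝ (Fin dL)) (xi0 : EuclideanSpace ℝ (Fin dX)) :
    ℕ → Ω → EuclideanSpace ℝ (Fin dL) :=
  fun t => Nat.rec (motive := fun _ => Ω → EuclideanSpace ℝ (Fin dL)) (fun _ => lam0)
    (fun s ih => fun ω =>
      projB B (ih ω + α s • G (Wp s ω) (ih ω) (xiSeq H β B Wp xi0 s ω))) t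

/-- Assumption 2. -/
structure Assumption2 {dW dL dX : ℕ}
    (ν : Measure (Wsp dW))
    (G : Wsp dW → EuclideanSpace ℝ (Fin dL) → EuclideanSpace ℝ (Fin dX) →
      EuclideanSpace ℝ (Fin dL))
    (H : Wsp dW → EuclideanSpace ℝ (Fin dX) → EuclideanSpace ℝ (Fin dX))
    (lamStar : EuclideanSpace ℝ (Fin dL)) (xiStar : EuclideanSpace ℝ (Fin dX))
    (B L ζ ψ : ℝ) : Prop where
  hGmeas : Measurable fun p : Wsp dW × EuclideanSpace ℝ (Fin dL) × EuclideanSpace ℝ (Fin dX) =>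
    G p.1 p.2.1 p.2.2
  hHmeas : Measurable fun p : Wsp dW × EuclideanSpace ℝ (Fin dX) => H p.1 p.2
  hHstar : (∫ w', H w' xiStar ∂ν) = 0
  hHuniq : ∀ ξ, (∫ w', H w' ξ ∂ν) = 0 → ξ = xiStar
  hGstar : (∫ w', G w' lamStar xiStar ∂ν) = 0
  hGuniq : ∀ lam, (∫ w', G w' lam xiStar ∂ν) = 0 → lam = lamStar
  hB : max ‖lamStar‖ ‖xiStar‖ < B
  hL : 0 < L
  hGLip : ∀ (w' : Wsp dW) lam lam' ξ ξ', ‖lam‖ ≤ B → ‖lam'‖ ≤ B → ‖ξ‖ ≤ B → ‖ξ'‖ ≤ B →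
    ‖G w' lam ξ - G w' lam' ξ'‖ ≤ L * (1 + ‖w'‖) * (‖lam - lam'‖ + ‖ξ - ξ'‖)
  hHLip : ∀ (w' : Wsp dW) ξ ξ', ‖ξ‖ ≤ B → ‖ξ'‖ ≤ B →
    ‖H w' ξ - H w' ξ'‖ ≤ L * (1 + ‖w'‖) * ‖ξ - ξ'‖
  hGgrow : ∀ (w' : Wsp dW) lam ξ, ‖lam‖ ≤ B → ‖ξ‖ ≤ B → ‖G w' lam ξ‖ ≤ L * (1 + ‖w'‖)
  hHgrow : ∀ (w' : Wsp dW) ξ, ‖ξ‖ ≤ B → ‖H w' ξ‖ ≤ L * (1 + ‖w'‖)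
  hζ : 0 < ζ
  hGmono : ∀ lam, ⟪lam - lamStar,
      (∫ w', G w' lam xiStar ∂ν) - (∫ w', G w' lamStar xiStar ∂ν)⟫
      ≤ -ζ * ‖lam - lamStar‖ ^ 2
  hψ : 0 < ψ
  hHmono : ∀ ξ, ⟪ξ - xiStar, (∫ w', H w' ξ ∂ν) - (∫ w', H w' xiStar ∂ν)⟫
      ≤ -ψ * ‖ξ - xiStar‖ ^ 2

section Recursion

lemma one_sub_div_le_rpow_neg {κ : ℝ} (hκ : 0 ≤ κ) (hκ1 : κ ≤ 1) {t : ℝ} (ht : 0 < t) :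
    t ^ (-κ) * (1 - κ / t) ≤ (t + 1) ^ (-κ) := by
  have h1 : (t + 1) ^ κ ≤ t ^ κ * (1 + κ / t) := by
    have := rpow_one_add_le_one_add_mul_self (s := 1 / t)
      (by have : 0 < 1 / t := by positivity
          linarith) hκ hκ1
    calc (t + 1) ^ κ = t ^ κ * (1 + 1 / t) ^ κ := by
          rw [← Real.mul_rpow ht.le (by positivity)]
          congr 1
          field_simp
      _ ≤ t ^ κ * (1 + κ * (1 / t)) := by gcongr
      _ = t ^ κ * (1 + κ / t) := by ring
  have hp : 0 < t ^ κ := Real.rpow_pos_of_pos ht κ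
  have hq : 0 < (t + 1) ^ κ := Real.rpow_pos_of_pos (by linarith) κ
  have hr : 0 ≤ κ / t := by positivity
  rw [Real.rpow_neg ht.le, Real.rpow_neg (by linarith), inv_mul_eq_div, div_le_iff₀ hp,
    inv_mul_eq_div, le_div_iff₀ hq]
  rcases le_total (1 - κ / t) 0 with h | h
  · nlinarith
  · calc (1 - κ / t) * (t + 1) ^ κ ≤ (1 - κ / t) * (t ^ κ * (1 + κ / t)) := by gcongr
      _ = t ^ κ * (1 - (κ / t) ^ 2) := by ring
      _ ≤ t ^ κ := by nlinarith [sq_nonneg (κ / t)]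

lemma rpow_neg_div_le_sq {κ : ℝ} (hκ1 : κ ≤ 1) {t : ℝ} (ht : 1 ≤ t) :
    t ^ (-κ) / t ≤ (t ^ (-κ)) ^ 2 := by
  have ht0 : 0 < t := by linarith
  rw [sq, div_eq_mul_inv]
  gcongr
  rw [← Real.rpow_neg_one]
  exact Real.rpow_le_rpow_of_exponent_le ht (by linarith)

/-- A scalar stochastic-approximation recursion has the rate of its step sizes. -/
lemma exists_le_mul_rpow_of_recursion {κ c D : ℝ} (hκ : 0 < κ) (hκ1 : κ ≤ 1) (hc : 0 < c)
    (hcone : κ = 1 → 1 < c) {b : ℕ → ℝ}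
    (hb : ∀ᶠ t : ℕ in atTop,
      b (t + 1) ≤ (1 - c * (t : ℝ) ^ (-κ)) * b t + D * ((t : ℝ) ^ (-κ)) ^ 2) :
    ∃ M : ℝ, 0 < M ∧ ∀ᶠ t : ℕ in atTop, b t ≤ M * (t : ℝ) ^ (-κ) := by
  obtain ⟨ε, hε, hev⟩ : ∃ ε > 0, ∀ᶠ t : ℕ in atTop, κ * (t : ℝ) ^ (κ - 1) ≤ c - ε := by
    rcases hκ1.eq_or_lt with h | h
    · subst h
      refine ⟨c - 1, by linarith [hcone rfl], Eventually.of_forall fun t => ?_⟩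
      simp
    · refine ⟨c / 2, by positivity, ?_⟩
      have h1 : Tendsto (fun t : ℕ => κ * (t : ℝ) ^ (-(1 - κ))) atTop (nhds (κ * 0)) :=
        ((tendsto_rpow_neg_atTop (by linarith)).comp tendsto_natCast_atTop_atTop).const_mul κ
      rw [mul_zero] at h1
      filter_upwards [h1.eventually_le_const (show (0 : ℝ) < c - c / 2 by linarith)] with t ht
      rwa [neg_sub] at ht
  have hev2 : ∀ᶠ t : ℕ in atTop, c * (t : ℝ) ^ (-κ) ≤ 1 := by
    have h1 : Tendsto (fun t : ℕ => c * (t : ℝ) ^ (-κ)) atTop (nhds (c * 0)) :=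
      ((tendsto_rpow_neg_atTop hκ).comp tendsto_natCast_atTop_atTop).const_mul c
    rw [mul_zero] at h1
    exact h1.eventually_le_const one_pos
  obtain ⟨T, hT⟩ := eventually_atTop.1 ((hb.and hev).and (hev2.and (eventually_ge_atTop 1)))
  set M : ℝ := max 1 (max (D / ε) (b T / (T : ℝ) ^ (-κ))) with hM
  have hM0 : 0 < M := lt_of_lt_of_le one_pos (le_max_left _ _)
  have hMD : D ≤ ε * M := by
    have : D / ε ≤ M := (le_max_left _ _).trans (le_max_right _ _)
    rw [div_le_iff₀ hε] at this
    linarith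
  refine ⟨M, hM0, eventually_atTop.2 ⟨T, fun t ht => ?_⟩⟩
  induction t, ht using Nat.le_induction with
  | base =>
    have h1 : 1 ≤ T := (hT T le_rfl).2.2
    have hp : 0 < (T : ℝ) ^ (-κ) := Real.rpow_pos_of_pos (by exact_mod_cast h1) _
    have : b T / (T : ℝ) ^ (-κ) ≤ M := (le_max_right _ _).trans (le_max_right _ _)
    rwa [div_le_iff₀ hp] at this
  | succ t ht ih =>
    obtain ⟨⟨h1, h2⟩, h3, h4⟩ := hT t ht
    have ht0 : (0 : ℝ) < t := by exact_mod_cast h4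
    have hlow := one_sub_div_le_rpow_neg hκ.le hκ1 ht0
    have hκt : κ / t = κ * (t : ℝ) ^ (κ - 1) * (t : ℝ) ^ (-κ) := by
      rw [mul_assoc, ← Real.rpow_add ht0, show κ - 1 + -κ = -1 by ring, Real.rpow_neg_one]
      rfl
    push_cast
    set s := (t : ℝ) ^ (-κ)
    have hs : 0 < s := Real.rpow_pos_of_pos ht0 _
    have h5 : κ / t ≤ (c - ε) * s := by rw [hκt]; gcongr
    calc b (t + 1) ≤ (1 - c * s) * b t + D * s ^ 2 := h1
      _ ≤ (1 - c * s) * (M * s) + (ε * M) * s ^ 2 := by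
          gcongr
      _ = M * (s * (1 - (c - ε) * s)) := by ring
      _ ≤ M * (s * (1 - κ / t)) := by gcongr
      _ ≤ M * (t + 1) ^ (-κ) := by gcongr

/-- A telescoping perturbation of the recursion does not change the rate. -/
lemma exists_le_mul_rpow_of_telescoping_recursion {κ c γ D C : ℝ} (hκ : 0 < κ) (hκ1 : κ ≤ 1)
    (hc : 0 < c) (hcone : κ = 1 → 1 < c) (hγ : 0 ≤ γ) {a u : ℕ → ℝ}
    (hu : ∀ t, |u t| ≤ C)
    (ha : ∀ᶠ t : ℕ in atTop, a (t + 1) ≤ (1 - c * (t : ℝ) ^ (-κ)) * a t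
      + γ * (t : ℝ) ^ (-κ) * (u t - u (t + 1)) + D * ((t : ℝ) ^ (-κ)) ^ 2) :
    ∃ M : ℝ, 0 < M ∧ ∀ᶠ t : ℕ in atTop, a t ≤ M * (t : ℝ) ^ (-κ) := by
  have hC : 0 ≤ C := (abs_nonneg _).trans (hu 0)
  obtain ⟨M, hM, hev⟩ := exists_le_mul_rpow_of_recursion (b := fun t => a t + γ * t ^ (-κ) * u t)
    (D := c * γ * C + γ * C + D) hκ hκ1 hc hcone (by
      filter_upwards [ha, eventually_ge_atTop 1] with t h1 h2
      have ht1 : (1 : ℝ) ≤ t := by exact_mod_cast h2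
      have ht0 : (0 : ℝ) < t := by linarith
      have hlow := one_sub_div_le_rpow_neg hκ.le hκ1 ht0
      have hsq := rpow_neg_div_le_sq hκ1 ht1
      have hup : ((t : ℝ) + 1) ^ (-κ) ≤ t ^ (-κ) :=
        Real.rpow_le_rpow_of_nonpos ht0 (by linarith) (by linarith)
      push_cast
      set s := (t : ℝ) ^ (-κ)
      set s' := ((t : ℝ) + 1) ^ (-κ)
      have hs : 0 < s := Real.rpow_pos_of_pos ht0 _
      have hdiff : |s' - s| ≤ s ^ 2 := by
        rw [abs_of_nonpos (by linarith)]
        have : s * (κ / t) ≤ s / t := by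
          rw [div_eq_mul_inv κ, div_eq_mul_inv s]
          have : 0 < s * (t : ℝ)⁻¹ := by positivity
          nlinarith
        linarith
      have e1 : (s' - s) * u (t + 1) ≤ s ^ 2 * C :=
        (le_abs_self _).trans (by rw [abs_mul]; gcongr; exact hu _)
      have e2 : s ^ 2 * u t ≤ s ^ 2 * C := by gcongr; exact (le_abs_self _).trans (hu t)
      have e3 := mul_le_mul_of_nonneg_left e1 hγ
      have e4 := mul_le_mul_of_nonneg_left e2 (mul_nonneg hc.le hγ)
      linarith)
  refine ⟨M + γ * C, by positivity, ?_⟩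
  filter_upwards [hev] with t ht
  have hs : 0 ≤ (t : ℝ) ^ (-κ) := by positivity
  have : -(γ * (t : ℝ) ^ (-κ) * u t) ≤ γ * (t : ℝ) ^ (-κ) * C := by
    rw [← mul_neg]
    gcongr
    exact (neg_le_abs _).trans (hu t)
  linarith

end Recursion

section Projection

variable {E : Type*} [NormedAddCommGroup E] [InnerProductSpace ℝ E]

lemma norm_projB_le {B : ℝ} (hB : 0 ≤ B) (x : E) : ‖projB B x‖ ≤ B := by
  unfold projB
  split_ifs with h
  · exact h
  · push Not at h
    have hx : 0 < ‖x‖ := hB.trans_lt h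
    rw [norm_smul, Real.norm_of_nonneg (by positivity), div_mul_cancel₀ _ hx.ne']

lemma norm_projB_sub_le {B : ℝ} (hB : 0 ≤ B) (x : E) {y : E} (hy : ‖y‖ ≤ B) :
    ‖projB B x - y‖ ≤ ‖x - y‖ := by
  unfold projB
  split_ifs with h
  · exact le_rfl
  · push Not at h
    have hx : 0 < ‖x‖ := hB.trans_lt h
    set r := B / ‖x‖ with hr
    have hrx : r * ‖x‖ = B := div_mul_cancel₀ _ hx.ne'
    have hr1 : r ≤ 1 := (div_le_one hx).2 h.le
    have hr0 : 0 ≤ r := by positivity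
    refine le_of_sq_le_sq ?_ (norm_nonneg _)
    rw [norm_sub_sq_real, norm_sub_sq_real, norm_smul, Real.norm_of_nonneg hr0,
      real_inner_smul_left]
    have hi : ⟪x, y⟫ ≤ ‖x‖ * B := (real_inner_le_norm x y).trans (by gcongr)
    have h2 : (1 - r) * ⟪x, y⟫ ≤ (1 - r) * (‖x‖ * B) :=
      mul_le_mul_of_nonneg_left hi (by linarith)
    nlinarith [mul_nonneg (sub_nonneg.2 hr1) (sq_nonneg (‖x‖ - B)), h2, hrx,
      mul_nonneg (sub_nonneg.2 hr1) (mul_nonneg hx.le (sub_nonneg.2 h.le))]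

lemma measurable_projB [MeasurableSpace E] [BorelSpace E] [SecondCountableTopology E] (B : ℝ) :
    Measurable (projB B : E → E) := by
  unfold projB
  exact Measurable.ite (measurableSet_le measurable_norm measurable_const) measurable_id
    ((measurable_const.div measurable_norm).smul measurable_id)

end Projection

section TotalVariation

variable {α : Type*} [MeasurableSpace α]

lemma add_negPart_eq_add_posPart (μ ν : Measure α) [IsFiniteMeasure μ] [IsFiniteMeasure ν] :
    μ + (μ.toSignedMeasure - ν.toSignedMeasure).toJordanDecomposition.negPart
      = ν + (μ.toSignedMeasure - ν.toSignedMeasure).toJordanDecomposition.posPart := by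
  have h := (μ.toSignedMeasure - ν.toSignedMeasure).toSignedMeasure_toJordanDecomposition
  rw [← Measure.toSignedMeasure_eq_toSignedMeasure_iff, Measure.toSignedMeasure_add,
    Measure.toSignedMeasure_add]
  unfold JordanDecomposition.toSignedMeasure at h
  rw [sub_eq_sub_iff_add_eq_add] at h
  rw [← h, add_comm]

lemma le_add_totalVariation (μ ν : Measure α) [IsFiniteMeasure μ] [IsFiniteMeasure ν] :
    μ ≤ ν + (μ.toSignedMeasure - ν.toSignedMeasure).totalVariation :=
  calc μ ≤ μ + (μ.toSignedMeasure - ν.toSignedMeasure).toJordanDecomposition.negPart :=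
        Measure.le_add_right le_rfl
    _ = ν + (μ.toSignedMeasure - ν.toSignedMeasure).toJordanDecomposition.posPart :=
        add_negPart_eq_add_posPart μ ν
    _ ≤ _ := by
        unfold SignedMeasure.totalVariation
        gcongr
        exact Measure.le_add_right le_rfl

lemma abs_integral_sub_integral_le_totalVariation {μ ν : Measure α} [IsFiniteMeasure μ]
    [IsFiniteMeasure ν] {f : α → ℝ} (hν : Integrable f ν)
    (hTV : Integrable f (μ.toSignedMeasure - ν.toSignedMeasure).totalVariation) :
    |∫ x, f x ∂μ - ∫ x, f x ∂ν|
      ≤ ∫ x, |f x| ∂(μ.toSignedMeasure - ν.toSignedMeasure).totalVariation := by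
  have hμ : Integrable f μ := (hν.add_measure hTV).mono_measure (le_add_totalVariation μ ν)
  have heq := add_negPart_eq_add_posPart μ ν
  unfold SignedMeasure.totalVariation at hTV ⊢
  have hp := hTV.left_of_add_measure
  have hn := hTV.right_of_add_measure
  have h := congrArg (fun m => ∫ x, f x ∂m) heq
  simp only [integral_add_measure hμ hn, integral_add_measure hν hp] at h
  rw [integral_add_measure hp.abs hn.abs]
  have h1 := abs_integral_le_integral_abs (f := f)
    (μ := (μ.toSignedMeasure - ν.toSignedMeasure).toJordanDecomposition.posPart)
  have h2 := abs_integral_le_integral_abs (f := f)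
    (μ := (μ.toSignedMeasure - ν.toSignedMeasure).toJordanDecomposition.negPart)
  rw [abs_le] at h1 h2 ⊢
  constructor <;> linarith

end TotalVariation

section Ergodicity

variable {dW : ℕ} {K : Kernel (Wsp dW) (Wsp dW)} [IsMarkovKernel K]
  {ν : Measure (Wsp dW)} [IsProbabilityMeasure ν] {c₁ ρ d : ℝ}

lemma UdBound.integrable_totalVariation (h : UdBound K ν c₁ ρ d) (t : ℕ) (w : Wsp dW) :
    Integrable (fun w' : Wsp dW => 1 + ‖w'‖ ^ d)
      ((kiter K t w).toSignedMeasure - ν.toSignedMeasure).totalVariation := by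
  set m := ((kiter K t w).toSignedMeasure - ν.toSignedMeasure).totalVariation
  have hpos : ∀ w' : Wsp dW, 0 ≤ 1 + ‖w'‖ ^ d := fun w' => by positivity
  have hmeas : Measurable fun w' : Wsp dW => 1 + ‖w'‖ ^ d := by fun_prop
  refine ⟨hmeas.aestronglyMeasurable, ?_⟩
  rw [hasFiniteIntegral_iff_ofReal (Eventually.of_forall hpos)]
  have hle : ∫⁻ w', ENNReal.ofReal (1 + ‖w'‖ ^ d) ∂m
      ≤ ∫⁻ w', ⨆ n : ℕ, ENNReal.ofReal (min (1 + ‖w'‖ ^ d) n) ∂m := by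
    refine lintegral_mono fun w' => ?_
    obtain ⟨n, hn⟩ := exists_nat_ge (1 + ‖w'‖ ^ d)
    exact le_iSup_of_le n (by rw [min_eq_left hn])
  refine (hle.trans_eq (lintegral_iSup (fun n => by fun_prop) fun n n' hn w' => ?_)).trans_lt ?_
  · have : (n : ℝ) ≤ n' := by exact_mod_cast hn
    dsimp only
    gcongr
  refine (iSup_le fun n => ?_).trans_lt
    (ENNReal.ofReal_lt_top (r := c₁ * ρ ^ t * (1 + ‖w‖ ^ d)))
  have hn0 : ∀ w' : Wsp dW, 0 ≤ min (1 + ‖w'‖ ^ d) (n : ℝ) := fun w' =>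
    le_min (hpos w') n.cast_nonneg
  have hint : Integrable (fun w' : Wsp dW => min (1 + ‖w'‖ ^ d) (n : ℝ)) m :=
    Integrable.of_bound (hmeas.min measurable_const).aestronglyMeasurable (n : ℝ)
      (Eventually.of_forall fun w' => by
        rw [Real.norm_of_nonneg (hn0 w')]
        exact min_le_right _ _)
  rw [← ofReal_integral_eq_lintegral_ofReal hint (Eventually.of_forall hn0)]
  refine ENNReal.ofReal_le_ofReal ?_
  have := h.2 t w (fun w' => min (1 + ‖w'‖ ^ d) (n : ℝ)) (by fun_prop) fun w' => by
    rw [abs_of_nonneg (hn0 w')]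
    exact min_le_left _ _
  simpa only [abs_of_nonneg (hn0 _)] using this

lemma UdBound.integrable_kiter (h : UdBound K ν c₁ ρ d) (t : ℕ) (w : Wsp dW) :
    Integrable (fun w' : Wsp dW => 1 + ‖w'‖ ^ d) (kiter K t w) :=
  (h.1.add_measure (h.integrable_totalVariation t w)).mono_measure (le_add_totalVariation _ _)

lemma UdBound.abs_integral_kiter_sub_le (h : UdBound K ν c₁ ρ d) (t : ℕ) (w : Wsp dW)
    {f : Wsp dW → ℝ} (hf : Measurable f) {A : ℝ} (hA : 0 ≤ A)
    (hfA : ∀ w', |f w'| ≤ A * (1 + ‖w'‖ ^ d)) :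
    |∫ w', f w' ∂(kiter K t w) - ∫ w', f w' ∂ν| ≤ A * (c₁ * ρ ^ t * (1 + ‖w‖ ^ d)) := by
  have hb : ∀ w' : Wsp dW, ‖f w'‖ ≤ ‖A * (1 + ‖w'‖ ^ d)‖ := fun w' =>
    (hfA w').trans (le_abs_self _)
  refine (abs_integral_sub_integral_le_totalVariation
    ((h.1.const_mul A).mono hf.aestronglyMeasurable (Eventually.of_forall hb))
    (((h.integrable_totalVariation t w).const_mul A).mono hf.aestronglyMeasurable
      (Eventually.of_forall hb))).trans ?_
  rcases hA.eq_or_lt with rfl | hA0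
  · have : f = 0 := funext fun w' => by simpa using hfA w'
    simp [this]
  have := h.2 t w (fun w' => A⁻¹ * f w') (hf.const_mul _) fun w' => by
    rw [abs_mul, abs_of_pos (inv_pos.2 hA0), inv_mul_le_iff₀ hA0]
    exact hfA w'
  simp only [abs_mul, abs_of_pos (inv_pos.2 hA0)] at this
  rwa [integral_const_mul, inv_mul_le_iff₀ hA0] at this

lemma UdBound.integral_kiter_le (h : UdBound K ν c₁ ρ d) (hc₁ : 0 ≤ c₁) (hρ₀ : 0 ≤ ρ)
    (hρ₁ : ρ ≤ 1) (t : ℕ) (w : Wsp dW) :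
    ∫ w', (1 + ‖w'‖ ^ d) ∂(kiter K t w)
      ≤ ∫ w', (1 + ‖w'‖ ^ d) ∂ν + c₁ * (1 + ‖w‖ ^ d) := by
  have h1 := h.abs_integral_kiter_sub_le t w (f := fun w' => 1 + ‖w'‖ ^ d) (by fun_prop)
    zero_le_one fun w' => by
      rw [one_mul, abs_of_nonneg (by positivity)]
  have h2 : c₁ * ρ ^ t * (1 + ‖w‖ ^ d) ≤ c₁ * 1 * (1 + ‖w‖ ^ d) := by
    gcongr
    exact pow_le_one₀ hρ₀ hρ₁
  rw [one_mul, abs_le] at h1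
  linarith [h1.2]

end Ergodicity

section KernelIterates

variable {α : Type*} [MeasurableSpace α]

lemma kiter_succ (K : Kernel α α) (n : ℕ) : kiter K (n + 1) = kiter K n ∘ₖ K := rfl

lemma kiter_succ' (K : Kernel α α) (n : ℕ) : kiter K (n + 1) = K ∘ₖ kiter K n := by
  induction n with
  | zero =>
    change Kernel.id ∘ₖ K = K ∘ₖ Kernel.id
    rw [Kernel.id_comp, Kernel.comp_id]
  | succ n ih => rw [kiter_succ, ih, Kernel.comp_assoc, ← kiter_succ, ← ih]

end KernelIterates

section MarkovProcess

variable {dW : ℕ} {Ω : Type*}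

/-- The σ-algebra generated by the process up to time `t`. -/
abbrev pastSigma (Wp : ℕ → Ω → Wsp dW) (t : ℕ) : MeasurableSpace Ω :=
  ⨆ s ∈ Finset.range (t + 1), MeasurableSpace.comap (Wp s) inferInstance

lemma pastSigma_mono (Wp : ℕ → Ω → Wsp dW) : Monotone (pastSigma Wp) := fun s t hst =>
  biSup_mono fun r hr => by
    rw [Finset.mem_range] at hr ⊢
    omega

lemma measurable_pastSigma (Wp : ℕ → Ω → Wsp dW) (t : ℕ) : Measurable[pastSigma Wp t] (Wp t) :=
  Measurable.mono (comap_measurable (Wp t))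
    (le_biSup (fun s => MeasurableSpace.comap (Wp s) inferInstance)
      (Finset.mem_range.2 (Nat.lt_succ_self t))) le_rfl

variable [mΩ : MeasurableSpace Ω] {K : Kernel (Wsp dW) (Wsp dW)} {P : Measure Ω}
  {Wp : ℕ → Ω → Wsp dW} {w : Wsp dW}

lemma IsMarkovProc.pastSigma_le (h : IsMarkovProc K P Wp w) (t : ℕ) : pastSigma Wp t ≤ mΩ :=
  iSup₂_le fun s _ => (h.meas s).comap_le

variable [IsMarkovKernel K] [IsProbabilityMeasure P]

lemma IsMarkovProc.measure_inter_preimage (h : IsMarkovProc K P Wp w) (t : ℕ) {A : Set Ω}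
    (hA : MeasurableSet[pastSigma Wp t] A) {S : Set (Wsp dW)} (hS : MeasurableSet S) :
    P (A ∩ Wp (t + 1) ⁻¹' S) = ∫⁻ ω in A, K (Wp t ω) S ∂P := by
  have hAm : MeasurableSet A := h.pastSigma_le t A hA
  have hSm : MeasurableSet (Wp (t + 1) ⁻¹' S) := h.meas (t + 1) hS
  have hone : ∀ x, |S.indicator (fun _ => (1 : ℝ)) x| ≤ 1 := fun x => by
    by_cases hx : x ∈ S <;> simp [hx]
  have hmark := h.markov t (S.indicator fun _ => 1) (measurable_const.indicator hS) ⟨1, hone⟩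
  have hint : Integrable (fun ω => S.indicator (fun _ => (1 : ℝ)) (Wp (t + 1) ω)) P :=
    Integrable.of_bound
      ((measurable_const.indicator hS).comp (h.meas (t + 1))).aestronglyMeasurable 1
      (Eventually.of_forall fun ω => hone _)
  have h1 := setIntegral_condExp (h.pastSigma_le t) hint hA
  rw [setIntegral_congr_ae hAm (hmark.mono fun ω hω _ => hω)] at h1
  simp only [integral_indicator hS, setIntegral_const, smul_eq_mul, mul_one] at h1
  have h2 : (fun ω => S.indicator (fun _ => (1 : ℝ)) (Wp (t + 1) ω))
      = (Wp (t + 1) ⁻¹' S).indicator fun _ => 1 := rfl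
  rw [h2, integral_indicator hSm, setIntegral_const, smul_eq_mul, mul_one,
    measureReal_restrict_apply hSm] at h1
  have h3 : ∫ ω in A, (K (Wp t ω)).real S ∂P = (∫⁻ ω in A, K (Wp t ω) S ∂P).toReal :=
    integral_toReal ((K.measurable_coe hS).comp (h.meas t)).aemeasurable
      (Eventually.of_forall fun ω => measure_lt_top _ _)
  have h4 : ∫⁻ ω in A, K (Wp t ω) S ∂P ≠ ⊤ := by
    refine ((lintegral_mono fun ω => prob_le_one (μ := K (Wp t ω)) (s := S)).trans_lt ?_).ne
    simp
  rw [h3, Set.inter_comm] at h1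
  exact ((ENNReal.toReal_eq_toReal_iff' h4 (measure_ne_top _ _)).1 h1).symm

variable {Θ : Type*} [MeasurableSpace Θ]

lemma IsMarkovProc.map_prodMk_eq (h : IsMarkovProc K P Wp w) (t : ℕ) {θ : Ω → Θ}
    (hθ : Measurable[pastSigma Wp t] θ) :
    P.map (fun ω => ((Wp t ω, θ ω), Wp (t + 1) ω))
      = (P.map fun ω => (Wp t ω, θ ω)) ⊗ₘ (K.comap Prod.fst measurable_fst) := by
  have hθm : Measurable θ := hθ.mono (h.pastSigma_le t) le_rfl
  have hZ : Measurable[pastSigma Wp t] fun ω => (Wp t ω, θ ω) :=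
    (measurable_pastSigma Wp t).prodMk hθ
  have hZm : Measurable fun ω => (Wp t ω, θ ω) := (h.meas t).prodMk hθm
  have : IsProbabilityMeasure (P.map fun ω => ((Wp t ω, θ ω), Wp (t + 1) ω)) :=
    Measure.isProbabilityMeasure_map (hZm.prodMk (h.meas _)).aemeasurable
  refine Measure.ext_prod fun {A S} hA hS => ?_
  rw [Measure.map_apply (hZm.prodMk (h.meas _)) (hA.prod hS), Measure.compProd_apply_prod hA hS,
    setLIntegral_map hA ((Kernel.measurable_coe _ hS)) hZm]
  exact h.measure_inter_preimage t (hZ hA) hS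

lemma IsMarkovProc.integral_succ (h : IsMarkovProc K P Wp w) (t : ℕ) {θ : Ω → Θ}
    (hθ : Measurable[pastSigma Wp t] θ) {g : Wsp dW → Θ → ℝ}
    (hg : Measurable (Function.uncurry g)) (hint : Integrable (fun ω => g (Wp (t + 1) ω) (θ ω)) P) :
    ∫ ω, g (Wp (t + 1) ω) (θ ω) ∂P = ∫ ω, ∫ w', g w' (θ ω) ∂(K (Wp t ω)) ∂P := by
  have hθm : Measurable θ := hθ.mono (h.pastSigma_le t) le_rfl
  have hZm : Measurable fun ω => (Wp t ω, θ ω) := (h.meas t).prodMk hθm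
  have hT : Measurable fun ω => ((Wp t ω, θ ω), Wp (t + 1) ω) := hZm.prodMk (h.meas _)
  have hG : Measurable fun p : (Wsp dW × Θ) × Wsp dW => g p.2 p.1.2 :=
    hg.comp (measurable_snd.prodMk measurable_fst.snd)
  have h1 : Integrable (fun p : (Wsp dW × Θ) × Wsp dW => g p.2 p.1.2)
      (P.map fun ω => ((Wp t ω, θ ω), Wp (t + 1) ω)) :=
    (integrable_map_measure hG.aestronglyMeasurable hT.aemeasurable).2 hint
  have h2 := integral_map hT.aemeasurable hG.aestronglyMeasurable (μ := P)
  rw [← h2]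
  rw [h.map_prodMk_eq t hθ] at h1 ⊢
  have : IsProbabilityMeasure (P.map fun ω => (Wp t ω, θ ω)) :=
    Measure.isProbabilityMeasure_map hZm.aemeasurable
  rw [Measure.integral_compProd h1]
  have hM : StronglyMeasurable fun p : Wsp dW × Θ =>
      ∫ w', g w' p.2 ∂(K.comap Prod.fst measurable_fst p) :=
    StronglyMeasurable.integral_kernel_prod_right' (f := fun q : (Wsp dW × Θ) × Wsp dW => g q.2 q.1.2)
      hG.stronglyMeasurable
  rw [integral_map hZm.aemeasurable hM.aestronglyMeasurable]
  rfl

lemma IsMarkovProc.map_eq_kiter (h : IsMarkovProc K P Wp w) (t : ℕ) :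
    P.map (Wp t) = kiter K t w := by
  induction t with
  | zero =>
    rw [Measure.map_congr h.init, Measure.map_const, measure_univ, one_smul]
    exact (Kernel.id_apply w).symm
  | succ t ih =>
    ext S hS
    rw [Measure.map_apply (h.meas _) hS, kiter_succ', Kernel.comp_apply' _ _ _ hS, ← ih,
      lintegral_map (K.measurable_coe hS) (h.meas t)]
    simpa using h.measure_inter_preimage t MeasurableSet.univ hS

end MarkovProcess

section PoissonDecomposition

variable {dW : ℕ} {Ω : Type*} [MeasurableSpace Ω] {K : Kernel (Wsp dW) (Wsp dW)}
  [IsMarkovKernel K] {ν : Measure (Wsp dW)} [IsProbabilityMeasure ν] {c₁ ρ : ℝ}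
  {P : Measure Ω} [IsProbabilityMeasure P] {Wp : ℕ → Ω → Wsp dW} {w : Wsp dW}

lemma IsMarkovProc.exists_moment_bound (h : IsMarkovProc K P Wp w) (hU2 : UdBound K ν c₁ ρ 2)
    (hc₁ : 0 ≤ c₁) (hρ₀ : 0 ≤ ρ) (hρ₁ : ρ ≤ 1) :
    ∃ M : ℝ, 0 ≤ M ∧ ∀ t, Integrable (fun ω => (1 + ‖Wp t ω‖) ^ 2) P ∧
      ∫ ω, (1 + ‖Wp t ω‖) ^ 2 ∂P ≤ M := by
  refine ⟨2 * (∫ w', (1 + ‖w'‖ ^ (2 : ℝ)) ∂ν + c₁ * (1 + ‖w‖ ^ (2 : ℝ))), by positivity,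
    fun t => ?_⟩
  have hle : ∀ x : Wsp dW, (1 + ‖x‖) ^ 2 ≤ 2 * (1 + ‖x‖ ^ (2 : ℝ)) := fun x => by
    rw [Real.rpow_two]
    nlinarith [sq_nonneg (‖x‖ - 1)]
  have hint2 : Integrable (fun x : Wsp dW => 2 * (1 + ‖x‖ ^ (2 : ℝ))) (kiter K t w) :=
    (hU2.integrable_kiter t w).const_mul 2
  have hint : Integrable (fun x : Wsp dW => (1 + ‖x‖) ^ 2) (kiter K t w) :=
    hint2.mono' (by fun_prop) (Eventually.of_forall fun x => by
      rw [Real.norm_of_nonneg (by positivity)]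
      exact hle x)
  have hmap := h.map_eq_kiter t
  constructor
  · rw [← hmap] at hint
    exact hint.comp_measurable (h.meas t)
  · have h1 : ∫ ω, (1 + ‖Wp t ω‖) ^ 2 ∂P = ∫ x, (1 + ‖x‖) ^ 2 ∂(kiter K t w) := by
      rw [← hmap, integral_map (h.meas t).aemeasurable
        (f := fun x : Wsp dW => (1 + ‖x‖) ^ 2) (by fun_prop)]
    rw [h1]
    calc ∫ x, (1 + ‖x‖) ^ 2 ∂(kiter K t w)
        ≤ ∫ x, 2 * (1 + ‖x‖ ^ (2 : ℝ)) ∂(kiter K t w) := integral_mono hint hint2 hle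
      _ = 2 * ∫ x, (1 + ‖x‖ ^ (2 : ℝ)) ∂(kiter K t w) := integral_const_mul _ _
      _ ≤ _ := by
        gcongr
        exact hU2.integral_kiter_le hc₁ hρ₀ hρ₁ t w

variable {Θ : Type*} [MeasurableSpace Θ]

/-- The mean of a centred Markovian noise term telescopes, up to the increments of the adapted
parameter `θ`: this is the Poisson-equation decomposition. -/
lemma IsMarkovProc.exists_telescoping_bound (h : IsMarkovProc K P Wp w)
    (hU1 : UdBound K ν c₁ ρ 1) (hU2 : UdBound K ν c₁ ρ 2)
    (hc₁ : 0 ≤ c₁) (hρ₀ : 0 ≤ ρ) (hρ₁ : ρ < 1) {θ : ℕ → Ω → Θ}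
    (hθ : ∀ t, Measurable[pastSigma Wp t] (θ t)) {Γ : Wsp dW → Θ → ℝ}
    (hΓ : Measurable (Function.uncurry Γ)) {s : ℕ → ℝ} (hs : ∀ t, 0 ≤ s t) {A : ℝ} (hA : 0 ≤ A)
    (hbd : ∀ t ω w', |Γ w' (θ t ω)| ≤ A * (1 + ‖w'‖))
    (hlip : ∀ t ω w', |Γ w' (θ (t + 1) ω) - Γ w' (θ t ω)|
      ≤ A * (s t * (1 + ‖Wp t ω‖)) * (1 + ‖w'‖))
    (hcent : ∀ t ω, ∫ w', Γ w' (θ t ω) ∂ν = 0) :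
    ∃ (C : ℝ) (u : ℕ → ℝ), (∀ t, |u t| ≤ C) ∧
      ∀ t, ∫ ω, Γ (Wp t ω) (θ t ω) ∂P ≤ u t - u (t + 1) + C * s t := by
  obtain ⟨M, hM, hmom⟩ := h.exists_moment_bound hU2 hc₁ hρ₀ hρ₁.le
  have hθm : ∀ t, Measurable (θ t) := fun t => (hθ t).mono (h.pastSigma_le t) le_rfl
  have hΓθ : ∀ t ω, Measurable fun w' => Γ w' (θ t ω) := fun t ω =>
    hΓ.comp (measurable_id.prodMk measurable_const)
  have hK1 : ∀ n x, Integrable (fun w' : Wsp dW => 1 + ‖w'‖) (kiter K n x) := fun n x => by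
    simpa only [Real.rpow_one] using hU1.integrable_kiter n x
  have hν1 : Integrable (fun w' : Wsp dW => 1 + ‖w'‖) ν := by
    simpa only [Real.rpow_one] using hU1.1
  have hΓint : ∀ n x t ω, Integrable (fun w' => Γ w' (θ t ω)) (kiter K n x) := fun n x t ω =>
    ((hK1 n x).const_mul A).mono' (hΓθ t ω).aestronglyMeasurable
      (Eventually.of_forall (hbd t ω))
  have hΓν : ∀ t ω, Integrable (fun w' => Γ w' (θ t ω)) ν := fun t ω =>
    (hν1.const_mul A).mono' (hΓθ t ω).aestronglyMeasurable (Eventually.of_forall (hbd t ω))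
  set Q : ℕ → Wsp dW → Θ → ℝ := fun n x y => ∫ w', Γ w' y ∂(kiter K n x) with hQ
  have hQm : ∀ n, Measurable (Function.uncurry (Q n)) := fun n =>
    (StronglyMeasurable.integral_kernel_prod_right' (κ := (kiter K n).comap Prod.fst measurable_fst)
      (f := fun q : (Wsp dW × Θ) × Wsp dW => Γ q.2 q.1.2)
      (hΓ.comp (measurable_snd.prodMk measurable_fst.snd)).stronglyMeasurable).measurable
  have hQ0 : ∀ x y, Q 0 x y = Γ x y := fun x y => by
    have hm : StronglyMeasurable fun w' => Γ w' y :=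
      (hΓ.comp (measurable_id.prodMk measurable_const)).stronglyMeasurable
    change ∫ w', Γ w' y ∂(Kernel.id x) = _
    rw [Kernel.id_apply, integral_dirac' _ _ hm]
  have hQsucc : ∀ n x t ω, ∫ w', Q n w' (θ t ω) ∂(K x) = Q (n + 1) x (θ t ω) := fun n x t ω =>
    (Kernel.integral_comp (hΓint (n + 1) x t ω)).symm
  have hQbd : ∀ n x t ω, |Q n x (θ t ω)| ≤ A * (c₁ * ρ ^ n * (1 + ‖x‖)) := fun n x t ω => by
    have := hU1.abs_integral_kiter_sub_le n x (hΓθ t ω) hA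
      (by simpa only [Real.rpow_one] using hbd t ω)
    simpa only [hcent, sub_zero, Real.rpow_one] using this
  have hQlip : ∀ n x t ω, |Q n x (θ (t + 1) ω) - Q n x (θ t ω)|
      ≤ A * (s t * (1 + ‖Wp t ω‖)) * (c₁ * ρ ^ n * (1 + ‖x‖)) := fun n x t ω => by
    have hst := hs t
    have := hU1.abs_integral_kiter_sub_le n x ((hΓθ (t + 1) ω).sub (hΓθ t ω))
      (A := A * (s t * (1 + ‖Wp t ω‖))) (by positivity)
      (by simpa only [Pi.sub_apply, Real.rpow_one] using hlip t ω)
    simpa only [Pi.sub_apply, integral_sub (hΓint n x _ ω) (hΓint n x _ ω),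
      integral_sub (hΓν _ ω) (hΓν _ ω), hcent, sub_zero, Real.rpow_one] using this
  have hWint : ∀ t, Integrable (fun ω => 1 + ‖Wp t ω‖) P := fun t =>
    (hmom t).1.mono' (((h.meas t).norm.const_add 1).aestronglyMeasurable)
      (Eventually.of_forall fun ω => by
        rw [Real.norm_of_nonneg (by positivity)]
        nlinarith [norm_nonneg (Wp t ω)])
  have hWle : ∀ t, ∫ ω, (1 + ‖Wp t ω‖) ∂P ≤ M := fun t =>
    (integral_mono (hWint t) (hmom t).1 fun ω => by
      nlinarith [norm_nonneg (Wp t ω)]).trans (hmom t).2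
  have hQint : ∀ n r t, Integrable (fun ω => Q n (Wp r ω) (θ t ω)) P := fun n r t =>
    ((hWint r).const_mul (A * (c₁ * ρ ^ n))).mono'
      ((hQm n).comp ((h.meas r).prodMk (hθm t))).aestronglyMeasurable
      (Eventually.of_forall fun ω => (hQbd n (Wp r ω) t ω).trans_eq (by ring))
  set e : ℕ → ℕ → ℝ := fun n t => ∫ ω, Q n (Wp t ω) (θ t ω) ∂P with he
  set F : ℝ := A * c₁ * M with hF
  have hF0 : 0 ≤ F := by positivity
  have hebd : ∀ t n, ‖e n t‖ ≤ F * ρ ^ n := fun t n => by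
    calc ‖e n t‖ ≤ ∫ ω, A * (c₁ * ρ ^ n) * (1 + ‖Wp t ω‖) ∂P :=
          norm_integral_le_of_norm_le ((hWint t).const_mul _)
            (Eventually.of_forall fun ω => (hQbd n (Wp t ω) t ω).trans_eq (by ring))
      _ = A * (c₁ * ρ ^ n) * ∫ ω, (1 + ‖Wp t ω‖) ∂P := integral_const_mul _ _
      _ ≤ A * (c₁ * ρ ^ n) * M := by
          gcongr
          exact hWle t
      _ = F * ρ ^ n := by rw [hF]; ring
  have hesucc : ∀ n t, e (n + 1) t = ∫ ω, Q n (Wp (t + 1) ω) (θ t ω) ∂P := fun n t => by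
    rw [h.integral_succ t (hθ t) (hQm n) (hQint n (t + 1) t)]
    simp only [hQsucc, he]
  have hediff : ∀ t n, ‖e n (t + 1) - e (n + 1) t‖ ≤ F * s t * ρ ^ n := fun t n => by
    have hst := hs t
    rw [hesucc, he, ← integral_sub (hQint n _ _) (hQint n _ _)]
    calc ‖∫ ω, (Q n (Wp (t + 1) ω) (θ (t + 1) ω) - Q n (Wp (t + 1) ω) (θ t ω)) ∂P‖
        ≤ ∫ ω, A * c₁ * s t * ρ ^ n
            * ((1 + ‖Wp t ω‖) ^ 2 / 2 + (1 + ‖Wp (t + 1) ω‖) ^ 2 / 2) ∂P := by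
          refine norm_integral_le_of_norm_le
            ((((hmom t).1.div_const 2).add ((hmom (t + 1)).1.div_const 2)).const_mul _)
            (Eventually.of_forall fun ω => (hQlip n (Wp (t + 1) ω) t ω).trans ?_)
          calc A * (s t * (1 + ‖Wp t ω‖)) * (c₁ * ρ ^ n * (1 + ‖Wp (t + 1) ω‖))
              = A * c₁ * s t * ρ ^ n * ((1 + ‖Wp t ω‖) * (1 + ‖Wp (t + 1) ω‖)) := by ring
            _ ≤ _ := by
              gcongr
              nlinarith [sq_nonneg ((1 + ‖Wp t ω‖) - (1 + ‖Wp (t + 1) ω‖))]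
      _ = A * c₁ * s t * ρ ^ n
            * ((∫ ω, (1 + ‖Wp t ω‖) ^ 2 ∂P) / 2 + (∫ ω, (1 + ‖Wp (t + 1) ω‖) ^ 2 ∂P) / 2) := by
          rw [integral_const_mul, integral_add ((hmom t).1.div_const 2)
            ((hmom (t + 1)).1.div_const 2), integral_div, integral_div]
      _ ≤ A * c₁ * s t * ρ ^ n * (M / 2 + M / 2) := by
          gcongr
          · exact (hmom t).2
          · exact (hmom (t + 1)).2
      _ = F * s t * ρ ^ n := by rw [hF]; ring
  have hgeo : ∀ a : ℝ, HasSum (fun n => a * ρ ^ n) (a * (1 - ρ)⁻¹) := fun a =>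
    (hasSum_geometric_of_lt_one hρ₀ hρ₁).mul_left a
  have hsum : ∀ t, Summable fun n => e n t := fun t =>
    Summable.of_norm_bounded (hgeo F).summable (hebd t)
  refine ⟨F * (1 - ρ)⁻¹, fun t => ∑' n, e n t, fun t => ?_, fun t => ?_⟩
  · exact tsum_of_norm_bounded (hgeo F) (hebd t)
  · have h0 : ∫ ω, Γ (Wp t ω) (θ t ω) ∂P = e 0 t := by simp only [he, hQ0]
    have hsplit := (hsum t).tsum_eq_zero_add
    have hd := tsum_of_norm_bounded (hgeo (F * s t)) (hediff t)
    rw [(hsum (t + 1)).tsum_sub ((summable_nat_add_iff 1).2 (hsum t)), Real.norm_eq_abs,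
      abs_le] at hd
    simp only [h0, hsplit]
    have : F * s t * (1 - ρ)⁻¹ = F * (1 - ρ)⁻¹ * s t := by ring
    linarith [hd.2]

end PoissonDecomposition

section ProjectedApproximation

variable {dW : ℕ} {Ω : Type*} [MeasurableSpace Ω] {K : Kernel (Wsp dW) (Wsp dW)}
  [IsMarkovKernel K] {ν : Measure (Wsp dW)} [IsProbabilityMeasure ν] {c₁ ρ : ℝ}
  {P : Measure Ω} [IsProbabilityMeasure P] {Wp : ℕ → Ω → Wsp dW} {w : Wsp dW}
  {Θ : Type*} [MeasurableSpace Θ]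
  {E : Type*} [NormedAddCommGroup E] [InnerProductSpace ℝ E] [CompleteSpace E]
  [MeasurableSpace E] [BorelSpace E] [SecondCountableTopology E]

/-- Mean-square rate of a projected stochastic-approximation iterate `φ (θ t)` driven by Markovian
noise, where the driving parameter `θ t` may carry further components, whose influence on the drift
is controlled by `e t`. -/
theorem IsMarkovProc.exists_rate_projected (h : IsMarkovProc K P Wp w)
    (hU1 : UdBound K ν c₁ ρ 1) (hU2 : UdBound K ν c₁ ρ 2)
    (hc₁ : 0 ≤ c₁) (hρ₀ : 0 ≤ ρ) (hρ₁ : ρ < 1) {θ : ℕ → Ω → Θ}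
    (hθ : ∀ t, Measurable[pastSigma Wp t] (θ t)) {φ : Θ → E} (hφ : Measurable φ)
    {g : Wsp dW → Θ → E} (hg : Measurable (Function.uncurry g)) {B L S D a₀ κ c : ℝ}
    (hL : 0 ≤ L) (hS : 0 ≤ S) (ha₀ : 0 < a₀) (hκ : 0 < κ) (hκ1 : κ ≤ 1)
    (hc : 0 < c) (hcone : κ = 1 → 1 < 2 * a₀ * c) {xs : E} (hxs : ‖xs‖ ≤ B)
    (hball : ∀ t ω, ‖φ (θ t ω)‖ ≤ B)
    (hstep : ∀ t ω, φ (θ (t + 1) ω)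
      = projB B (φ (θ t ω) + (a₀ * (t : ℝ) ^ (-κ)) • g (Wp t ω) (θ t ω)))
    (hgrow : ∀ t ω w', ‖g w' (θ t ω)‖ ≤ L * (1 + ‖w'‖))
    (hlip : ∀ t ω w', ‖g w' (θ (t + 1) ω) - g w' (θ t ω)‖
      ≤ L * (1 + ‖w'‖) * (S * (t : ℝ) ^ (-κ) * (1 + ‖Wp t ω‖)))
    {e : ℕ → Ω → ℝ} (heint : ∀ t, Integrable (e t) P)
    (he : ∀ᶠ t : ℕ in atTop, ∫ ω, e t ω ∂P ≤ D * (t : ℝ) ^ (-κ))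
    (hdrift : ∀ t ω, ⟪φ (θ t ω) - xs, ∫ w', g w' (θ t ω) ∂ν⟫
      ≤ -c * ‖φ (θ t ω) - xs‖ ^ 2 + e t ω) :
    ∃ M : ℝ, 0 < M ∧
      ∀ᶠ t : ℕ in atTop, ∫ ω, ‖φ (θ t ω) - xs‖ ^ 2 ∂P ≤ M * (t : ℝ) ^ (-κ) := by
  have hB : 0 ≤ B := (norm_nonneg _).trans hxs
  obtain ⟨M₂, hM₂, hmom⟩ := h.exists_moment_bound hU2 hc₁ hρ₀ hρ₁.le
  have hθm : ∀ t, Measurable (θ t) := fun t => (hθ t).mono (h.pastSigma_le t) le_rfl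
  have hs : ∀ t : ℕ, 0 ≤ (t : ℝ) ^ (-κ) := fun t => by positivity
  have hν1 : Integrable (fun w' : Wsp dW => 1 + ‖w'‖) ν := by
    simpa only [Real.rpow_one] using hU1.1
  have hgθ : ∀ t ω, Integrable (fun w' => g w' (θ t ω)) ν := fun t ω =>
    (hν1.const_mul L).mono'
      (hg.comp (measurable_id.prodMk measurable_const)).aestronglyMeasurable
      (Eventually.of_forall (hgrow t ω))
  set k : ℝ := ∫ w', (1 + ‖w'‖) ∂ν with hk
  have hk0 : 0 ≤ k := integral_nonneg fun w' => by positivity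
  set gm : Θ → E := fun y => ∫ w', g w' y ∂ν with hgm
  have hgm_meas : Measurable gm :=
    (StronglyMeasurable.integral_prod_left (μ := ν) (f := g) hg.stronglyMeasurable).measurable
  have hgm_le : ∀ t ω, ‖gm (θ t ω)‖ ≤ L * k := fun t ω =>
    (norm_integral_le_of_norm_le (hν1.const_mul L) (Eventually.of_forall (hgrow t ω))).trans_eq
      (integral_const_mul _ _)
  have hgm_lip : ∀ t ω, ‖gm (θ (t + 1) ω) - gm (θ t ω)‖
      ≤ L * (S * (t : ℝ) ^ (-κ) * (1 + ‖Wp t ω‖)) * k := fun t ω => by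
    rw [hgm, ← integral_sub (hgθ _ _) (hgθ _ _)]
    exact (norm_integral_le_of_norm_le (hν1.const_mul _) (Eventually.of_forall fun w' =>
      (hlip t ω w').trans_eq (mul_right_comm _ _ _))).trans_eq (integral_const_mul _ _)
  have hdev : ∀ t ω w', ‖g w' (θ t ω) - gm (θ t ω)‖ ≤ L * (1 + k) * (1 + ‖w'‖) :=
    fun t ω w' => by
    have h1 : 0 ≤ L * (k * ‖w'‖) := by positivity
    have := (norm_sub_le _ _).trans (add_le_add (hgrow t ω w') (hgm_le t ω))
    linarith
  have hdist : ∀ t ω, ‖φ (θ t ω) - xs‖ ≤ 2 * B := fun t ω =>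
    (norm_sub_le _ _).trans (by linarith [hball t ω])
  have hinc : ∀ t ω, ‖φ (θ (t + 1) ω) - φ (θ t ω)‖
      ≤ a₀ * L * ((t : ℝ) ^ (-κ) * (1 + ‖Wp t ω‖)) := fun t ω => by
    have hst := hs t
    rw [hstep]
    refine (norm_projB_sub_le hB _ (hball t ω)).trans ?_
    rw [add_sub_cancel_left, norm_smul, Real.norm_of_nonneg (by positivity)]
    calc a₀ * (t : ℝ) ^ (-κ) * ‖g (Wp t ω) (θ t ω)‖
        ≤ a₀ * (t : ℝ) ^ (-κ) * (L * (1 + ‖Wp t ω‖)) := by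
          gcongr
          exact hgrow t ω _
      _ = _ := by ring
  set Γ : Wsp dW → Θ → ℝ := fun w' y => ⟪φ y - xs, g w' y - gm y⟫ with hΓ
  have hΓm : Measurable (Function.uncurry Γ) :=
    ((hφ.comp measurable_snd).sub_const xs).inner (hg.sub (hgm_meas.comp measurable_snd))
  set A : ℝ := L * (1 + k) * (a₀ * L + 2 * B * S + 2 * B) with hA
  have hΓbd : ∀ t ω w', |Γ w' (θ t ω)| ≤ A * (1 + ‖w'‖) := fun t ω w' =>
    calc |Γ w' (θ t ω)| ≤ ‖φ (θ t ω) - xs‖ * ‖g w' (θ t ω) - gm (θ t ω)‖ :=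
          abs_real_inner_le_norm _ _
      _ ≤ (2 * B) * (L * (1 + k) * (1 + ‖w'‖)) := by
          gcongr
          exacts [hdist t ω, hdev t ω w']
      _ = L * (1 + k) * (0 + 0 + 2 * B) * (1 + ‖w'‖) := by ring
      _ ≤ A * (1 + ‖w'‖) := by
          rw [hA]
          gcongr <;> positivity
  have hΓlip : ∀ t ω w', |Γ w' (θ (t + 1) ω) - Γ w' (θ t ω)|
      ≤ A * ((t : ℝ) ^ (-κ) * (1 + ‖Wp t ω‖)) * (1 + ‖w'‖) := fun t ω w' => by
    have hst := hs t
    set r : ℝ := (t : ℝ) ^ (-κ) * (1 + ‖Wp t ω‖) with hr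
    have hr0 : 0 ≤ r := by positivity
    have h1 : ‖(g w' (θ (t + 1) ω) - gm (θ (t + 1) ω)) - (g w' (θ t ω) - gm (θ t ω))‖
        ≤ L * (1 + k) * (S * r) * (1 + ‖w'‖) := by
      rw [sub_sub_sub_comm]
      refine (norm_sub_le _ _).trans ((add_le_add (hlip t ω w') (hgm_lip t ω)).trans ?_)
      rw [mul_assoc S, ← hr]
      have : 0 ≤ L * (S * r) * (k * ‖w'‖) := by positivity
      linarith
    have h2 : Γ w' (θ (t + 1) ω) - Γ w' (θ t ω)
        = ⟪φ (θ (t + 1) ω) - φ (θ t ω), g w' (θ (t + 1) ω) - gm (θ (t + 1) ω)⟫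
          + ⟪φ (θ t ω) - xs,
            (g w' (θ (t + 1) ω) - gm (θ (t + 1) ω)) - (g w' (θ t ω) - gm (θ t ω))⟫ := by
      rw [← sub_sub_sub_cancel_right (φ (θ (t + 1) ω)) _ xs, inner_sub_left,
        inner_sub_right (φ (θ t ω) - xs) (g w' (θ (t + 1) ω) - gm (θ (t + 1) ω))]
      simp only [hΓ]
      ring
    rw [h2]
    calc _ ≤ ‖φ (θ (t + 1) ω) - φ (θ t ω)‖ * ‖g w' (θ (t + 1) ω) - gm (θ (t + 1) ω)‖
          + ‖φ (θ t ω) - xs‖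
            * ‖(g w' (θ (t + 1) ω) - gm (θ (t + 1) ω)) - (g w' (θ t ω) - gm (θ t ω))‖ :=
          (abs_add_le _ _).trans
            (add_le_add (abs_real_inner_le_norm _ _) (abs_real_inner_le_norm _ _))
      _ ≤ (a₀ * L * r) * (L * (1 + k) * (1 + ‖w'‖))
          + (2 * B) * (L * (1 + k) * (S * r) * (1 + ‖w'‖)) := by
          gcongr
          exacts [hinc t ω, hdev _ ω w', hdist t ω]
      _ = L * (1 + k) * (a₀ * L + 2 * B * S + 0) * r * (1 + ‖w'‖) := by ring
      _ ≤ A * r * (1 + ‖w'‖) := by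
          rw [hA]
          gcongr
          positivity
  have hcent : ∀ t ω, ∫ w', Γ w' (θ t ω) ∂ν = 0 := fun t ω => by
    have hi : Integrable (fun w' => g w' (θ t ω) - gm (θ t ω)) ν :=
      (hgθ t ω).sub (integrable_const _)
    simp only [hΓ]
    rw [integral_inner hi, integral_sub (hgθ t ω) (integrable_const _)]
    simp [hgm]
  obtain ⟨C, u, hu, htel⟩ := h.exists_telescoping_bound hU1 hU2 hc₁ hρ₀ hρ₁ hθ hΓm hs
    (by positivity) hΓbd hΓlip hcent
  have hX : ∀ t, Integrable (fun ω => ‖φ (θ t ω) - xs‖ ^ 2) P := fun t =>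
    Integrable.of_bound
      (((hφ.comp (hθm t)).sub_const xs).norm.pow_const 2).aestronglyMeasurable ((2 * B) ^ 2)
      (Eventually.of_forall fun ω => by
        rw [Real.norm_of_nonneg (by positivity)]
        gcongr
        exact hdist t ω)
  have hΓP : ∀ t, Integrable (fun ω => Γ (Wp t ω) (θ t ω)) P := fun t =>
    ((hmom t).1.const_mul A).mono' (hΓm.comp ((h.meas t).prodMk (hθm t))).aestronglyMeasurable
      (Eventually.of_forall fun ω => (hΓbd t ω (Wp t ω)).trans (by
        gcongr
        nlinarith [norm_nonneg (Wp t ω)]))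
  have hpt : ∀ (t : ℕ) ω, ‖φ (θ (t + 1) ω) - xs‖ ^ 2
      ≤ (1 - 2 * a₀ * c * (t : ℝ) ^ (-κ)) * ‖φ (θ t ω) - xs‖ ^ 2
        + 2 * a₀ * (t : ℝ) ^ (-κ) * Γ (Wp t ω) (θ t ω)
        + 2 * a₀ * (t : ℝ) ^ (-κ) * e t ω
        + (a₀ * (t : ℝ) ^ (-κ) * L) ^ 2 * (1 + ‖Wp t ω‖) ^ 2 := fun t ω => by
    have hst := hs t
    set r : ℝ := (t : ℝ) ^ (-κ)
    have h1 : ‖φ (θ (t + 1) ω) - xs‖ ≤ ‖(φ (θ t ω) - xs) + (a₀ * r) • g (Wp t ω) (θ t ω)‖ := by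
      rw [hstep, sub_add_eq_add_sub]
      exact norm_projB_sub_le hB _ hxs
    have h2 : ‖(a₀ * r) • g (Wp t ω) (θ t ω)‖ ≤ a₀ * r * (L * (1 + ‖Wp t ω‖)) := by
      rw [norm_smul, Real.norm_of_nonneg (by positivity)]
      gcongr
      exact hgrow t ω _
    have h3 : ⟪φ (θ t ω) - xs, g (Wp t ω) (θ t ω)⟫
        = Γ (Wp t ω) (θ t ω) + ⟪φ (θ t ω) - xs, gm (θ t ω)⟫ := by
      simp only [hΓ, inner_sub_right]
      ring
    have h4 : 2 * (a₀ * r) * ⟪φ (θ t ω) - xs, gm (θ t ω)⟫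
        ≤ 2 * (a₀ * r) * (-c * ‖φ (θ t ω) - xs‖ ^ 2 + e t ω) := by
      gcongr
      exact hdrift t ω
    calc ‖φ (θ (t + 1) ω) - xs‖ ^ 2
        ≤ ‖(φ (θ t ω) - xs) + (a₀ * r) • g (Wp t ω) (θ t ω)‖ ^ 2 := by gcongr
      _ = ‖φ (θ t ω) - xs‖ ^ 2 + 2 * ((a₀ * r) * ⟪φ (θ t ω) - xs, g (Wp t ω) (θ t ω)⟫)
          + ‖(a₀ * r) • g (Wp t ω) (θ t ω)‖ ^ 2 := by
          rw [norm_add_sq_real, real_inner_smul_right]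
      _ ≤ ‖φ (θ t ω) - xs‖ ^ 2 + 2 * ((a₀ * r) * ⟪φ (θ t ω) - xs, g (Wp t ω) (θ t ω)⟫)
          + (a₀ * r * (L * (1 + ‖Wp t ω‖))) ^ 2 := by gcongr
      _ ≤ _ := by
          rw [h3]
          linarith
  have hrec : ∀ t : ℕ, ∫ ω, ‖φ (θ (t + 1) ω) - xs‖ ^ 2 ∂P
      ≤ (1 - 2 * a₀ * c * (t : ℝ) ^ (-κ)) * ∫ ω, ‖φ (θ t ω) - xs‖ ^ 2 ∂P
        + 2 * a₀ * (t : ℝ) ^ (-κ) * ∫ ω, Γ (Wp t ω) (θ t ω) ∂P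
        + 2 * a₀ * (t : ℝ) ^ (-κ) * ∫ ω, e t ω ∂P
        + (a₀ * (t : ℝ) ^ (-κ) * L) ^ 2 * ∫ ω, (1 + ‖Wp t ω‖) ^ 2 ∂P := fun t => by
    have i1 := (hX t).const_mul (1 - 2 * a₀ * c * (t : ℝ) ^ (-κ))
    have i2 := (hΓP t).const_mul (2 * a₀ * (t : ℝ) ^ (-κ))
    have i3 := (heint t).const_mul (2 * a₀ * (t : ℝ) ^ (-κ))
    have i4 := (hmom t).1.const_mul ((a₀ * (t : ℝ) ^ (-κ) * L) ^ 2)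
    refine (integral_mono (hX (t + 1)) (((i1.add i2).add i3).add i4) (hpt t)).trans_eq ?_
    rw [integral_add' ((i1.add i2).add i3) i4, integral_add' (i1.add i2) i3,
      integral_add' i1 i2]
    simp only [integral_const_mul]
  refine exists_le_mul_rpow_of_telescoping_recursion (c := 2 * a₀ * c) (γ := 2 * a₀)
    (D := 2 * a₀ * C + 2 * a₀ * D + a₀ ^ 2 * L ^ 2 * M₂) hκ hκ1 (by positivity) hcone
    (by positivity) hu ?_
  filter_upwards [he] with t het
  have hst := hs t
  set r : ℝ := (t : ℝ) ^ (-κ)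
  have b1 := mul_le_mul_of_nonneg_left (htel t) (show 0 ≤ 2 * a₀ * r by positivity)
  have b2 := mul_le_mul_of_nonneg_left het (show 0 ≤ 2 * a₀ * r by positivity)
  have b3 := mul_le_mul_of_nonneg_left (hmom t).2 (show 0 ≤ (a₀ * r * L) ^ 2 by positivity)
  linarith [hrec t]

end ProjectedApproximation

section TwoTimescale

variable {dW dL dX : ℕ} {Ω : Type*} {Wp : ℕ → Ω → Wsp dW}
  {G : Wsp dW → EuclideanSpace ℝ (Fin dL) → EuclideanSpace ℝ (Fin dX) →
    EuclideanSpace ℝ (Fin dL)}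
  {H : Wsp dW → EuclideanSpace ℝ (Fin dX) → EuclideanSpace ℝ (Fin dX)}
  {α β : ℕ → ℝ} {B : ℝ} {lam0 : EuclideanSpace ℝ (Fin dL)} {xi0 : EuclideanSpace ℝ (Fin dX)}

theorem xiSeq_succ (t : ℕ) (ω : Ω) : xiSeq H β B Wp xi0 (t + 1) ω
    = projB B (xiSeq H β B Wp xi0 t ω + β t • H (Wp t ω) (xiSeq H β B Wp xi0 t ω)) :=
  rfl

theorem lamSeq_succ (t : ℕ) (ω : Ω) : lamSeq G H α β B Wp lam0 xi0 (t + 1) ω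
    = projB B (lamSeq G H α β B Wp lam0 xi0 t ω
      + α t • G (Wp t ω) (lamSeq G H α β B Wp lam0 xi0 t ω) (xiSeq H β B Wp xi0 t ω)) :=
  rfl

theorem norm_xiSeq_le (hxi0 : ‖xi0‖ ≤ B) (t : ℕ) (ω : Ω) : ‖xiSeq H β B Wp xi0 t ω‖ ≤ B := by
  cases t with
  | zero => exact hxi0
  | succ t => exact norm_projB_le ((norm_nonneg _).trans hxi0) _

theorem norm_lamSeq_le (hlam0 : ‖lam0‖ ≤ B) (t : ℕ) (ω : Ω) :
    ‖lamSeq G H α β B Wp lam0 xi0 t ω‖ ≤ B := by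
  cases t with
  | zero => exact hlam0
  | succ t => exact norm_projB_le ((norm_nonneg _).trans hlam0) _

theorem measurable_xiSeq
    (hH : Measurable fun p : Wsp dW × EuclideanSpace ℝ (Fin dX) => H p.1 p.2) (t : ℕ) :
    Measurable[pastSigma Wp t] (xiSeq H β B Wp xi0 t) := by
  induction t with
  | zero => exact measurable_const
  | succ t ih =>
    have hξ : Measurable[pastSigma Wp (t + 1)] (xiSeq H β B Wp xi0 t) :=
      ih.mono (pastSigma_mono Wp (Nat.le_succ t)) le_rfl
    have hW : Measurable[pastSigma Wp (t + 1)] (Wp t) :=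
      (measurable_pastSigma Wp t).mono (pastSigma_mono Wp (Nat.le_succ t)) le_rfl
    exact (measurable_projB B).comp
      (hξ.add ((hH.comp (hW.prodMk hξ)).const_smul (β t)))

theorem measurable_lamSeq
    (hG : Measurable fun p : Wsp dW × EuclideanSpace ℝ (Fin dL) × EuclideanSpace ℝ (Fin dX) =>
      G p.1 p.2.1 p.2.2)
    (hH : Measurable fun p : Wsp dW × EuclideanSpace ℝ (Fin dX) => H p.1 p.2) (t : ℕ) :
    Measurable[pastSigma Wp t] (lamSeq G H α β B Wp lam0 xi0 t) := by
  induction t with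
  | zero => exact measurable_const
  | succ t ih =>
    have hl : Measurable[pastSigma Wp (t + 1)] (lamSeq G H α β B Wp lam0 xi0 t) :=
      ih.mono (pastSigma_mono Wp (Nat.le_succ t)) le_rfl
    have hξ : Measurable[pastSigma Wp (t + 1)] (xiSeq H β B Wp xi0 t) :=
      (measurable_xiSeq hH t).mono (pastSigma_mono Wp (Nat.le_succ t)) le_rfl
    have hW : Measurable[pastSigma Wp (t + 1)] (Wp t) :=
      (measurable_pastSigma Wp t).mono (pastSigma_mono Wp (Nat.le_succ t)) le_rfl
    exact (measurable_projB B).comp (hl.add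
      ((hG.comp (hW.prodMk (hl.prodMk hξ))).const_smul (α t)))

variable {ν : Measure (Wsp dW)} {lamStar : EuclideanSpace ℝ (Fin dL)}
  {xiStar : EuclideanSpace ℝ (Fin dX)} {L ζ ψ : ℝ}

theorem Assumption2.norm_xiSeq_succ_sub_le (hA2 : Assumption2 ν G H lamStar xiStar B L ζ ψ)
    (hxi0 : ‖xi0‖ ≤ B) {t : ℕ} (hβ : 0 ≤ β t) (ω : Ω) :
    ‖xiSeq H β B Wp xi0 (t + 1) ω - xiSeq H β B Wp xi0 t ω‖ ≤ β t * (L * (1 + ‖Wp t ω‖)) := by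
  rw [xiSeq_succ]
  refine (norm_projB_sub_le ((norm_nonneg _).trans hxi0) _ (norm_xiSeq_le hxi0 t ω)).trans ?_
  rw [add_sub_cancel_left, norm_smul, Real.norm_of_nonneg hβ]
  gcongr
  exact hA2.hHgrow _ _ (norm_xiSeq_le hxi0 t ω)

theorem Assumption2.norm_lamSeq_succ_sub_le (hA2 : Assumption2 ν G H lamStar xiStar B L ζ ψ)
    (hlam0 : ‖lam0‖ ≤ B) (hxi0 : ‖xi0‖ ≤ B) {t : ℕ} (hα : 0 ≤ α t) (ω : Ω) :
    ‖lamSeq G H α β B Wp lam0 xi0 (t + 1) ω - lamSeq G H α β B Wp lam0 xi0 t ω‖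
      ≤ α t * (L * (1 + ‖Wp t ω‖)) := by
  rw [lamSeq_succ]
  refine (norm_projB_sub_le ((norm_nonneg _).trans hxi0) _ (norm_lamSeq_le hlam0 t ω)).trans ?_
  rw [add_sub_cancel_left, norm_smul, Real.norm_of_nonneg hα]
  gcongr
  exact hA2.hGgrow _ _ _ (norm_lamSeq_le hlam0 t ω) (norm_xiSeq_le hxi0 t ω)

/-- The averaged fast drift, perturbed by the error of the slow variable. -/
theorem Assumption2.inner_integral_le (hA2 : Assumption2 ν G H lamStar xiStar B L ζ ψ)
    (hν1 : Integrable (fun w' : Wsp dW => 1 + ‖w'‖) ν)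
    {lam : EuclideanSpace ℝ (Fin dL)} {ξ : EuclideanSpace ℝ (Fin dX)} (hlam : ‖lam‖ ≤ B)
    (hξ : ‖ξ‖ ≤ B) :
    ⟪lam - lamStar, ∫ w', G w' lam ξ ∂ν⟫ ≤ -(ζ / 2) * ‖lam - lamStar‖ ^ 2
      + (L * ∫ w', (1 + ‖w'‖) ∂ν) ^ 2 / (2 * ζ) * ‖ξ - xiStar‖ ^ 2 := by
  have hζ := hA2.hζ
  have hxs : ‖xiStar‖ ≤ B := (le_max_right _ _).trans hA2.hB.le
  have hint : ∀ ξ', ‖ξ'‖ ≤ B → Integrable (fun w' => G w' lam ξ') ν := fun ξ' hξ' =>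
    (hν1.const_mul L).mono'
      (hA2.hGmeas.comp
        (measurable_id.prodMk (measurable_const (a := (lam, ξ'))))).aestronglyMeasurable
      (Eventually.of_forall fun w' => hA2.hGgrow w' _ _ hlam hξ')
  set k : ℝ := ∫ w', (1 + ‖w'‖) ∂ν
  have hdiff : ‖(∫ w', G w' lam ξ ∂ν) - ∫ w', G w' lam xiStar ∂ν‖ ≤ L * k * ‖ξ - xiStar‖ := by
    rw [← integral_sub (hint ξ hξ) (hint xiStar hxs)]
    refine (norm_integral_le_of_norm_le (hν1.const_mul (L * ‖ξ - xiStar‖))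
      (Eventually.of_forall fun w' => ?_)).trans_eq ?_
    · have := hA2.hGLip w' lam lam ξ xiStar hlam hlam hξ hxs
      rw [sub_self, norm_zero, zero_add] at this
      exact this.trans_eq (mul_right_comm _ _ _)
    · rw [integral_const_mul]
      exact mul_right_comm _ _ _
  have hmono := hA2.hGmono lam
  rw [hA2.hGstar, sub_zero] at hmono
  have hcross := (real_inner_le_norm (lam - lamStar)
    ((∫ w', G w' lam ξ ∂ν) - ∫ w', G w' lam xiStar ∂ν)).trans
      (mul_le_mul_of_nonneg_left hdiff (norm_nonneg _))
  rw [inner_sub_right] at hcross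
  have hyoung : ‖lam - lamStar‖ * (L * k * ‖ξ - xiStar‖)
      ≤ ζ / 2 * ‖lam - lamStar‖ ^ 2 + (L * k) ^ 2 / (2 * ζ) * ‖ξ - xiStar‖ ^ 2 := by
    have h1 : ζ / 2 * ‖lam - lamStar‖ ^ 2 + (L * k) ^ 2 / (2 * ζ) * ‖ξ - xiStar‖ ^ 2
        - ‖lam - lamStar‖ * (L * k * ‖ξ - xiStar‖)
        = (ζ * ‖lam - lamStar‖ - L * k * ‖ξ - xiStar‖) ^ 2 / (2 * ζ) := by
      field_simp
      ring
    have h2 : 0 ≤ (ζ * ‖lam - lamStar‖ - L * k * ‖ξ - xiStar‖) ^ 2 / (2 * ζ) := by positivity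
    linarith
  linarith

variable [MeasurableSpace Ω] {K : Kernel (Wsp dW) (Wsp dW)} [IsMarkovKernel K]
  [IsProbabilityMeasure ν] {c₁ ρ : ℝ} {P : Measure Ω} [IsProbabilityMeasure P] {w : Wsp dW}
  {α₀ β₀ κ δ : ℝ}

/-- Mean-square rate of the slow iterate. -/
theorem IsMarkovProc.exists_rate_xiSeq (h : IsMarkovProc K P Wp w)
    (hU1 : UdBound K ν c₁ ρ 1) (hU2 : UdBound K ν c₁ ρ 2)
    (hc₁ : 0 ≤ c₁) (hρ₀ : 0 ≤ ρ) (hρ₁ : ρ < 1)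
    (hA2 : Assumption2 ν G H lamStar xiStar B L ζ ψ) (hβ₀ : 0 < β₀) (hδ : 0 < δ) (hδ1 : δ ≤ 1)
    (hδone : δ = 1 → 1 < ψ * β₀) (hxi0 : ‖xi0‖ ≤ B) :
    ∃ M : ℝ, 0 < M ∧ ∀ᶠ t : ℕ in atTop,
      ∫ ω, ‖xiSeq H (fun s => β₀ * (s : ℝ) ^ (-δ)) B Wp xi0 t ω - xiStar‖ ^ 2 ∂P
        ≤ M * (t : ℝ) ^ (-δ) := by
  have hL := hA2.hL
  refine h.exists_rate_projected hU1 hU2 hc₁ hρ₀ hρ₁ (measurable_xiSeq hA2.hHmeas)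
    measurable_id (g := H) hA2.hHmeas (L := L) (S := β₀ * L) (c := ψ) (D := 0)
    (e := fun _ _ => 0) hL.le (by positivity) hβ₀ hδ hδ1 hA2.hψ
    (fun h1 => by nlinarith [hδone h1]) ((le_max_right _ _).trans hA2.hB.le)
    (norm_xiSeq_le hxi0) xiSeq_succ
    (fun t ω w' => hA2.hHgrow _ _ (norm_xiSeq_le hxi0 t ω)) (fun t ω w' => ?_)
    (fun t => integrable_zero _ _ _) (by simp) (fun t ω => ?_)
  · refine (hA2.hHLip w' _ _ (norm_xiSeq_le hxi0 _ ω) (norm_xiSeq_le hxi0 t ω)).trans ?_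
    refine mul_le_mul_of_nonneg_left ?_ (by positivity)
    refine (hA2.norm_xiSeq_succ_sub_le hxi0 (by positivity) ω).trans_eq ?_
    ring
  · have := hA2.hHmono (xiSeq H (fun s => β₀ * (s : ℝ) ^ (-δ)) B Wp xi0 t ω)
    rw [hA2.hHstar, sub_zero] at this
    simpa using this

/-- Mean-square rate of the fast iterate. -/
theorem IsMarkovProc.exists_rate_lamSeq (h : IsMarkovProc K P Wp w)
    (hU1 : UdBound K ν c₁ ρ 1) (hU2 : UdBound K ν c₁ ρ 2)
    (hc₁ : 0 ≤ c₁) (hρ₀ : 0 ≤ ρ) (hρ₁ : ρ < 1)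
    (hA2 : Assumption2 ν G H lamStar xiStar B L ζ ψ) (hα₀ : 0 < α₀) (hβ₀ : 0 < β₀)
    (hκ : 0 < κ) (hκδ : κ ≤ δ) (hδ1 : δ ≤ 1)
    (hκone : κ = 1 → 1 < ζ * α₀) (hδone : δ = 1 → 1 < ψ * β₀)
    (hlam0 : ‖lam0‖ ≤ B) (hxi0 : ‖xi0‖ ≤ B) :
    ∃ M : ℝ, 0 < M ∧ ∀ᶠ t : ℕ in atTop,
      ∫ ω, ‖lamSeq G H (fun s => α₀ * (s : ℝ) ^ (-κ)) (fun s => β₀ * (s : ℝ) ^ (-δ))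
        B Wp lam0 xi0 t ω - lamStar‖ ^ 2 ∂P ≤ M * (t : ℝ) ^ (-κ) := by
  obtain ⟨M, hM, hrate⟩ := h.exists_rate_xiSeq (xi0 := xi0) hU1 hU2 hc₁ hρ₀ hρ₁ hA2 hβ₀
    (hκ.trans_le hκδ) hδ1 hδone hxi0
  have hL := hA2.hL
  have hζ := hA2.hζ
  have hν1 : Integrable (fun w' : Wsp dW => 1 + ‖w'‖) ν := by
    simpa only [Real.rpow_one] using hU1.1
  have hpow : ∀ t : ℕ, (t : ℝ) ^ (-δ) ≤ (t : ℝ) ^ (-κ) := fun t => by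
    rcases t.eq_zero_or_pos with rfl | ht
    · rw [Nat.cast_zero, Real.zero_rpow (by linarith), Real.zero_rpow (by linarith)]
    · exact Real.rpow_le_rpow_of_exponent_le (mod_cast ht) (neg_le_neg hκδ)
  set ξ := xiSeq H (fun s => β₀ * (s : ℝ) ^ (-δ)) B Wp xi0
  set l := lamSeq G H (fun s => α₀ * (s : ℝ) ^ (-κ)) (fun s => β₀ * (s : ℝ) ^ (-δ)) B Wp lam0 xi0
  have hξm : ∀ t, Measurable[pastSigma Wp t] (ξ t) := measurable_xiSeq hA2.hHmeas
  have hlm : ∀ t, Measurable[pastSigma Wp t] (l t) := measurable_lamSeq hA2.hGmeas hA2.hHmeas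
  have hξb : ∀ t ω, ‖ξ t ω‖ ≤ B := norm_xiSeq_le hxi0
  have hlb : ∀ t ω, ‖l t ω‖ ≤ B := norm_lamSeq_le hlam0
  have hξstep : ∀ t ω, ‖ξ (t + 1) ω - ξ t ω‖ ≤ β₀ * (t : ℝ) ^ (-δ) * (L * (1 + ‖Wp t ω‖)) :=
    fun t ω => hA2.norm_xiSeq_succ_sub_le hxi0 (by positivity) ω
  have hlstep : ∀ t ω, ‖l (t + 1) ω - l t ω‖ ≤ α₀ * (t : ℝ) ^ (-κ) * (L * (1 + ‖Wp t ω‖)) :=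
    fun t ω => hA2.norm_lamSeq_succ_sub_le hlam0 hxi0 (by positivity) ω
  have hlsucc : ∀ t ω, l (t + 1) ω
      = projB B (l t ω + (α₀ * (t : ℝ) ^ (-κ)) • G (Wp t ω) (l t ω) (ξ t ω)) := lamSeq_succ
  clear_value l ξ
  set q : ℝ := (L * ∫ w', (1 + ‖w'‖) ∂ν) ^ 2 / (2 * ζ)
  have hq0 : 0 ≤ q := by positivity
  refine h.exists_rate_projected hU1 hU2 hc₁ hρ₀ hρ₁ (θ := fun t ω => (l t ω, ξ t ω))
    (fun t => (hlm t).prodMk (hξm t)) measurable_fst (g := fun w' p => G w' p.1 p.2)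
    hA2.hGmeas (L := L) (S := (α₀ + β₀) * L) (c := ζ / 2) (D := q * M)
    (e := fun t ω => q * ‖ξ t ω - xiStar‖ ^ 2) hL.le (by positivity) hα₀ hκ (hκδ.trans hδ1)
    (by positivity) (fun h1 => by linarith [hκone h1]) ((le_max_left _ _).trans hA2.hB.le) hlb
    hlsucc (fun t ω w' => hA2.hGgrow _ _ _ (hlb t ω) (hξb t ω)) (fun t ω w' => ?_)
    (fun t => ?_) ?_ (fun t ω => hA2.inner_integral_le hν1 (hlb t ω) (hξb t ω))
  · refine (hA2.hGLip w' _ _ _ _ (hlb _ ω) (hlb t ω) (hξb _ ω) (hξb t ω)).trans ?_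
    refine mul_le_mul_of_nonneg_left ?_ (by positivity)
    have h1 := mul_le_mul_of_nonneg_right (hpow t)
      (show 0 ≤ β₀ * (L * (1 + ‖Wp t ω‖)) by positivity)
    linarith [hlstep t ω, hξstep t ω]
  · refine (Integrable.of_bound (C := (B + ‖xiStar‖) ^ 2)
      ((((hξm t).mono (h.pastSigma_le t) le_rfl).sub_const
        xiStar).norm.pow_const 2).aestronglyMeasurable
      (Eventually.of_forall fun ω => ?_)).const_mul q
    rw [Real.norm_of_nonneg (by positivity)]
    gcongr
    exact (norm_sub_le _ _).trans (by gcongr; exact hξb t ω)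
  · filter_upwards [hrate] with t ht
    rw [integral_const_mul, mul_assoc]
    gcongr
    exact ht.trans (mul_le_mul_of_nonneg_left (hpow t) hM.le)

end TwoTimescale

/-- Proposition 1(i): finite-time risk bound for the fast iterate. -/
theorem proposition1_i
    {dW dL dX : ℕ} {Ω : Type*} [MeasurableSpace Ω]
    (K : Kernel (Wsp dW) (Wsp dW)) [IsMarkovKernel K]
    (ν : Measure (Wsp dW)) [IsProbabilityMeasure ν]
    (hstat : ν.bind (⇑K) = ν)
    (c₁ ρ : ℝ) (hc₁ : 0 < c₁) (hρ₀ : 0 ≤ ρ) (hρ₁ : ρ < 1)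
    (hU1 : UdBound K ν c₁ ρ 1) (hU2 : UdBound K ν c₁ ρ 2)
    (G : Wsp dW → EuclideanSpace ℝ (Fin dL) → EuclideanSpace ℝ (Fin dX) →
      EuclideanSpace ℝ (Fin dL))
    (H : Wsp dW → EuclideanSpace ℝ (Fin dX) → EuclideanSpace ℝ (Fin dX))
    (lamStar : EuclideanSpace ℝ (Fin dL)) (xiStar : EuclideanSpace ℝ (Fin dX))
    (B L ζ ψ : ℝ)
    (hA2 : Assumption2 ν G H lamStar xiStar B L ζ ψ)
    (α₀ β₀ κ δ : ℝ) (hα₀ : 0 < α₀) (hβ₀ : 0 < β₀)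
    (hκpos : 0 < κ) (hκδ : κ ≤ δ) (hδ1 : δ ≤ 1)
    (hκone : κ = 1 → 1 < ζ * α₀) (hδone : δ = 1 → 1 < ψ * β₀)
    (P : Measure Ω) [IsProbabilityMeasure P]
    (Wp : ℕ → Ω → Wsp dW) (w : Wsp dW)
    (hMP : IsMarkovProc K P Wp w)
    (lam0 : EuclideanSpace ℝ (Fin dL)) (xi0 : EuclideanSpace ℝ (Fin dX))
    (hlam0 : ‖lam0‖ ≤ B) (hxi0 : ‖xi0‖ ≤ B) :
    (∃ k₁ k₂ : ℝ, 0 ≤ k₁ ∧ 0 < k₂ ∧ ∃ T : ℕ, ∀ t : ℕ, T ≤ t →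
        (∫ ω, ‖lamSeq G H (fun s => α₀ * (s : ℝ) ^ (-κ)) (fun s => β₀ * (s : ℝ) ^ (-δ))
            B Wp lam0 xi0 t ω - lamStar‖ ^ 2 ∂P)
          ≤ (t : ℝ) ^ (-κ) * (k₁ * Real.log t + k₂)) ∧
    ((∀ w', K w' = ν) →
      ∃ k₂ : ℝ, 0 < k₂ ∧ ∃ T : ℕ, ∀ t : ℕ, T ≤ t →
        (∫ ω, ‖lamSeq G H (fun s => α₀ * (s : ℝ) ^ (-κ)) (fun s => β₀ * (s : ℝ) ^ (-δ))
            B Wp lam0 xi0 t ω - lamStar‖ ^ 2 ∂P)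
          ≤ (t : ℝ) ^ (-κ) * k₂) := by
  obtain ⟨M, hM, hrate⟩ := hMP.exists_rate_lamSeq (lam0 := lam0) hU1 hU2 hc₁.le hρ₀ hρ₁ hA2 hα₀
    hβ₀ hκpos hκδ hδ1 hκone hδone hlam0 hxi0
  obtain ⟨T, hT⟩ := eventually_atTop.1 hrate
  refine ⟨⟨0, M, le_rfl, hM, T, fun t ht => ?_⟩, fun _ => ⟨M, hM, T, fun t ht => ?_⟩⟩
  · rw [zero_mul, zero_add, mul_comm]
    exact hT t ht
  · rw [mul_comm]
    exact hT t ht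

end
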